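/- arXiv:2506.03298 — 3 statements merged into one kernel-verified Lean document; each statement's English description precedes it below -/
import Mathlib

section
/- Theorem 1 (attack detection via residual convergence). Let E be a finite-dimensional real inner product space and let f : E → E be the unperturbed closed-loop error vector field. Suppose V : E → ℝ is differentiable and there are constants c1, c2, c3, c4 > 0 such that for all q ∈ E: c1·‖q‖² ≤ V(q) ≤ c2·‖q‖², (fderiv V q)(f q) ≤ −c3·‖q‖², and ‖fderiv V q‖ ≤ c4·‖q‖. Let c5 > 0 and suppose the error trajectory p : [0,∞) → E is differentiable and satisfies p'(t) = f(p(t)) + Δ(t), where the perturbation Δ : [0,∞) → E satisfies ‖Δ(t)‖ ≤ 6·c5·‖p(t)‖ for all t ≥ 0. Let K : F → G be a c5-Lipschitz map between normed real vector spaces (the controller output map) and let a, b : [0,∞) → F satisfy ‖a(t) − b(t)‖ ≤ ‖p(t)‖ for all t ≥ 0. If c3 > 6·c5·c4, then the residual r(t) := K(a(t)) − K(b(t)) tends to 0 as t → ∞. -/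
open Filter Topology

/-- A differential inequality `W' ≤ -k W` on `[0, ∞)` forces exponential decay. -/
theorem le_mul_exp_neg_of_hasDerivAt_le {W W' : ℝ → ℝ} {k : ℝ}
    (hW : ∀ t ≥ (0 : ℝ), HasDerivAt W (W' t) t)
    (hle : ∀ t ≥ (0 : ℝ), W' t ≤ -k * W t) {t : ℝ} (ht : 0 ≤ t) :
    W t ≤ W 0 * Real.exp (-k * t) := by
  have hg : ∀ s ≥ (0 : ℝ), HasDerivAt (fun s => W s * Real.exp (k * s))
      (W' s * Real.exp (k * s) + W s * (Real.exp (k * s) * k)) s := fun s hs =>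
    (hW s hs).mul (by simpa using ((hasDerivAt_id s).const_mul k).exp)
  have hanti : AntitoneOn (fun s => W s * Real.exp (k * s)) (Set.Ici 0) := by
    refine antitoneOn_of_hasDerivWithinAt_nonpos (convex_Ici 0)
      (fun s hs => (hg s hs).continuousAt.continuousWithinAt)
      (fun s hs => (hg s (interior_subset hs)).hasDerivWithinAt) fun s hs => ?_
    have h := mul_le_mul_of_nonneg_right (hle s (interior_subset hs)) (Real.exp_pos (k * s)).le
    linarith
  have h : W t * Real.exp (k * t) ≤ W 0 := by
    simpa using hanti Set.self_mem_Ici ht ht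
  rwa [neg_mul, Real.exp_neg, ← div_eq_mul_inv, le_div_iff₀ (Real.exp_pos _)]

/-- Robustness of a quadratic Lyapunov function: a perturbation that is linearly bounded with a
small enough constant preserves convergence to the origin. -/
theorem tendsto_norm_zero_of_perturbed_lyapunov
    {E : Type*} [NormedAddCommGroup E] [NormedSpace ℝ E]
    {f : E → E} {V : E → ℝ} (hV : Differentiable ℝ V) {c1 c2 c3 c4 δ : ℝ}
    (hc1 : 0 < c1) (hc2 : 0 < c2) (hc4 : 0 ≤ c4)
    (hlow : ∀ q : E, c1 * ‖q‖ ^ 2 ≤ V q)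
    (hupp : ∀ q : E, V q ≤ c2 * ‖q‖ ^ 2)
    (hdecay : ∀ q : E, fderiv ℝ V q (f q) ≤ -c3 * ‖q‖ ^ 2)
    (hgrad : ∀ q : E, ‖fderiv ℝ V q‖ ≤ c4 * ‖q‖)
    {p Δ : ℝ → E}
    (hp : ∀ t ≥ (0 : ℝ), HasDerivAt p (f (p t) + Δ t) t)
    (hΔ : ∀ t ≥ (0 : ℝ), ‖Δ t‖ ≤ δ * ‖p t‖)
    (hcond : δ * c4 < c3) :
    Tendsto (fun t => ‖p t‖) atTop (𝓝 0) := by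
  set k := (c3 - δ * c4) / c2
  have hkpos : 0 < k := div_pos (sub_pos.2 hcond) hc2
  have hkc : k * c2 = c3 - δ * c4 := div_mul_cancel₀ _ hc2.ne'
  have hder : ∀ t ≥ (0 : ℝ), fderiv ℝ V (p t) (f (p t) + Δ t) ≤ -k * V (p t) := by
    intro t ht
    have hpert : fderiv ℝ V (p t) (Δ t) ≤ c4 * ‖p t‖ * (δ * ‖p t‖) :=
      (le_abs_self _).trans <| ((fderiv ℝ V (p t)).le_opNorm _).trans <|
        mul_le_mul (hgrad _) (hΔ t ht) (norm_nonneg _) (by positivity)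
    have hkV := mul_le_mul_of_nonneg_left (hupp (p t)) hkpos.le
    rw [← mul_assoc, hkc] at hkV
    rw [map_add]
    linarith [hdecay (p t)]
  have hbound : ∀ t ≥ (0 : ℝ), ‖p t‖ ^ 2 ≤ V (p 0) / c1 * Real.exp (-k * t) := by
    intro t ht
    have hdec := le_mul_exp_neg_of_hasDerivAt_le (W := fun s => V (p s))
      (fun s hs => (hV (p s)).hasFDerivAt.comp_hasDerivAt s (hp s hs)) hder ht
    rw [div_mul_eq_mul_div, le_div_iff₀' hc1]
    exact (hlow _).trans hdec
  have hexp : Tendsto (fun t => V (p 0) / c1 * Real.exp (-k * t)) atTop (𝓝 0) := by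
    simpa using (Real.tendsto_exp_atBot.comp
      (tendsto_id.const_mul_atTop_of_neg (neg_neg_of_pos hkpos))).const_mul (V (p 0) / c1)
  have hsq : Tendsto (fun t => ‖p t‖ ^ 2) atTop (𝓝 0) :=
    squeeze_zero' (.of_forall fun _ => by positivity)
      ((eventually_ge_atTop 0).mono hbound) hexp
  simpa using hsq.sqrt

/-- Theorem 1 (attack detection via residual convergence). -/
theorem residual_converges_to_zero
    {E F G : Type*}
    [NormedAddCommGroup E] [InnerProductSpace ℝ E] [FiniteDimensional ℝ E]
    [NormedAddCommGroup F] [NormedSpace ℝ F]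
    [NormedAddCommGroup G] [NormedSpace ℝ G]
    (f : E → E) (V : E → ℝ) (hV : Differentiable ℝ V)
    (c1 c2 c3 c4 c5 : ℝ)
    (hc1 : 0 < c1) (hc2 : 0 < c2) (hc3 : 0 < c3) (hc4 : 0 < c4) (hc5 : 0 < c5)
    (hlow : ∀ q : E, c1 * ‖q‖ ^ 2 ≤ V q)
    (hupp : ∀ q : E, V q ≤ c2 * ‖q‖ ^ 2)
    (hdecay : ∀ q : E, fderiv ℝ V q (f q) ≤ -c3 * ‖q‖ ^ 2)
    (hgrad : ∀ q : E, ‖fderiv ℝ V q‖ ≤ c4 * ‖q‖)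
    (p Δ : ℝ → E)
    (hp : ∀ t ≥ (0 : ℝ), HasDerivAt p (f (p t) + Δ t) t)
    (hΔ : ∀ t ≥ (0 : ℝ), ‖Δ t‖ ≤ 6 * c5 * ‖p t‖)
    (K : F → G) (hK : ∀ x y : F, ‖K x - K y‖ ≤ c5 * ‖x - y‖)
    (a b : ℝ → F)
    (hab : ∀ t ≥ (0 : ℝ), ‖a t - b t‖ ≤ ‖p t‖)
    (hcond : c3 > 6 * c5 * c4) :
    Tendsto (fun t => K (a t) - K (b t)) atTop (𝓝 0) := by
  have hnorm : Tendsto (fun t => ‖p t‖) atTop (𝓝 0) :=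
    tendsto_norm_zero_of_perturbed_lyapunov hV hc1 hc2 hc4.le hlow hupp hdecay hgrad hp hΔ hcond
  refine squeeze_zero_norm' ?_ (by simpa using hnorm.const_mul c5)
  filter_upwards [eventually_ge_atTop 0] with t ht
  exact (hK _ _).trans (mul_le_mul_of_nonneg_left (hab t ht) hc5.le)
end

section
/- Convergence of the state estimation errors to zero under the detection scheme. Let E be a finite-dimensional real inner product space, f : E → E, and let V : E → ℝ be differentiable with constants c1, c2, c3, c4 > 0 such that for all q ∈ E: c1·‖q‖² ≤ V(q) ≤ c2·‖q‖², (fderiv V q)(f q) ≤ −c3·‖q‖², and ‖fderiv V q‖ ≤ c4·‖q‖. Let c5 > 0 with c3 > 6·c5·c4, and let p : [0,∞) → E be differentiable with p'(t) = f(p(t)) + Δ(t) and ‖Δ(t)‖ ≤ 6·c5·‖p(t)‖ for all t ≥ 0. Then ‖p(t)‖² ≤ (c2/c1)·‖p(0)‖²·exp(−((c3 − 6·c5·c4)/c2)·t) for all t ≥ 0; in particular p(t) → 0 as t → ∞. -/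
open Filter Topology

/-- A real function whose derivative on `[0, ∞)` is at most `-a` times the function is dominated by
the corresponding decaying exponential. -/
theorem le_mul_exp_of_hasDerivAt_le_neg_mul {v v' : ℝ → ℝ} {a : ℝ}
    (hv : ∀ t ≥ (0 : ℝ), HasDerivAt v (v' t) t) (hle : ∀ t ≥ (0 : ℝ), v' t ≤ -a * v t)
    {t : ℝ} (ht : 0 ≤ t) : v t ≤ v 0 * Real.exp (-a * t) := by
  have hd : ∀ s ≥ (0 : ℝ), HasDerivAt (fun s => v s * Real.exp (a * s))
      (v' s * Real.exp (a * s) + v s * (Real.exp (a * s) * a)) s := fun s hs => by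
    exact (hv s hs).mul (hasDerivAt_const_mul a).exp
  have hanti : AntitoneOn (fun s => v s * Real.exp (a * s)) (Set.Ici 0) := by
    refine antitoneOn_of_deriv_nonpos (convex_Ici 0)
      (fun s hs => (hd s hs).continuousAt.continuousWithinAt)
      (fun s hs => (hd s (interior_subset hs)).differentiableAt.differentiableWithinAt) ?_
    intro s hs
    have hs0 : 0 ≤ s := interior_subset hs
    rw [(hd s hs0).deriv]
    nlinarith [hle s hs0, Real.exp_pos (a * s)]
  have h : v t * Real.exp (a * t) ≤ v 0 := by
    simpa using hanti (Set.mem_Ici.2 le_rfl) (Set.mem_Ici.2 ht) ht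
  rw [neg_mul, Real.exp_neg, ← div_eq_mul_inv]
  exact (le_div_iff₀ (Real.exp_pos _)).2 h

/-- Convergence of the state estimation errors to zero under the detection scheme. -/
theorem detection_error_converges
    {E : Type*} [NormedAddCommGroup E] [InnerProductSpace ℝ E] [FiniteDimensional ℝ E]
    (f : E → E) (V : E → ℝ) (hV : Differentiable ℝ V)
    (c1 c2 c3 c4 c5 : ℝ)
    (hc1 : 0 < c1) (hc2 : 0 < c2) (hc3 : 0 < c3) (hc4 : 0 < c4) (hc5 : 0 < c5)
    (hlow : ∀ q : E, c1 * ‖q‖ ^ 2 ≤ V q)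
    (hupp : ∀ q : E, V q ≤ c2 * ‖q‖ ^ 2)
    (hdecay : ∀ q : E, fderiv ℝ V q (f q) ≤ -c3 * ‖q‖ ^ 2)
    (hgrad : ∀ q : E, ‖fderiv ℝ V q‖ ≤ c4 * ‖q‖)
    (hcond : c3 > 6 * c5 * c4)
    (p Δ : ℝ → E)
    (hp : ∀ t ≥ (0 : ℝ), HasDerivAt p (f (p t) + Δ t) t)
    (hΔ : ∀ t ≥ (0 : ℝ), ‖Δ t‖ ≤ 6 * c5 * ‖p t‖) :
    (∀ t ≥ (0 : ℝ),
      ‖p t‖ ^ 2 ≤ (c2 / c1) * ‖p 0‖ ^ 2 * Real.exp (-((c3 - 6 * c5 * c4) / c2) * t)) ∧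
    Tendsto p atTop (𝓝 0) := by
  set k := c3 - 6 * c5 * c4
  have hk0 : 0 < k := by linarith
  have hdV : ∀ t ≥ (0 : ℝ), HasDerivAt (V ∘ p) (fderiv ℝ V (p t) (f (p t) + Δ t)) t :=
    fun t ht => (hV (p t)).hasFDerivAt.comp_hasDerivAt t (hp t ht)
  have hdecayV : ∀ t ≥ (0 : ℝ),
      fderiv ℝ V (p t) (f (p t) + Δ t) ≤ -(k / c2) * (V ∘ p) t := by
    intro t ht
    have hpert : fderiv ℝ V (p t) (Δ t) ≤ (c4 * ‖p t‖) * (6 * c5 * ‖p t‖) :=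
      (Real.le_norm_self _).trans
        ((fderiv ℝ V (p t)).le_of_opNorm_le_of_le (hgrad (p t)) (hΔ t ht))
    have hV2 : k / c2 * V (p t) ≤ k * ‖p t‖ ^ 2 :=
      (mul_le_mul_of_nonneg_left (hupp (p t)) (by positivity)).trans_eq (by field_simp)
    rw [map_add, Function.comp_apply]
    nlinarith [hdecay (p t)]
  have hbound : ∀ t ≥ (0 : ℝ),
      ‖p t‖ ^ 2 ≤ (c2 / c1) * ‖p 0‖ ^ 2 * Real.exp (-(k / c2) * t) := by
    intro t ht
    have hexp := le_mul_exp_of_hasDerivAt_le_neg_mul hdV hdecayV ht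
    have h0 := mul_le_mul_of_nonneg_right (hupp (p 0)) (Real.exp_pos (-(k / c2) * t)).le
    rw [div_mul_eq_mul_div, div_mul_eq_mul_div, le_div_iff₀ hc1, mul_comm]
    exact (hlow (p t)).trans (hexp.trans h0)
  refine ⟨hbound, ?_⟩
  have hexp0 : Tendsto (fun t => Real.exp (-(k / c2) * t)) atTop (𝓝 0) :=
    Real.tendsto_exp_atBot.comp
      (tendsto_id.const_mul_atTop_of_neg (neg_lt_zero.2 (div_pos hk0 hc2)))
  have hsq : Tendsto (fun t => ‖p t‖ ^ 2) atTop (𝓝 0) :=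
    squeeze_zero' (Eventually.of_forall fun t => by positivity)
      ((eventually_ge_atTop 0).mono hbound)
      (by simpa using hexp0.const_mul ((c2 / c1) * ‖p 0‖ ^ 2))
  rw [tendsto_zero_iff_norm_tendsto_zero]
  simpa using hsq.sqrt
end

section
/- Bi-Lipschitz bound on the weight estimation error (the estimate (36)–(38) in the proof of Theorem 2). Let E, U, X, Z be normed real vector spaces. Let Φ : E → U satisfy the lower bi-Lipschitz bound c7·‖p − q‖ ≤ ‖Φ(p) − Φ(q)‖ for all p, q ∈ E, and let F : Z × X → E satisfy the lower bound in its first argument c9·‖z1 − z2‖ ≤ ‖F(z1, x) − F(z2, x)‖ for all z1, z2 ∈ Z and x ∈ X, where c7, c9 > 0. Fix x* ∈ X and z*, z*_n ∈ Z, and let w, δ̃ ∈ Z. Define the recovery signal z_r := Φ(F(w, x*)) and the attack signal α := −Φ(F(δ̃ + z*_n, x*) − F(z*, x*)). Then ‖w − δ̃‖ ≤ (1/(c7·c9))·(‖z_r + α‖ + c7·‖F(z*, x*)‖) + ‖z*_n‖. -/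
/-- Bi-Lipschitz bound on the weight estimation error. -/
theorem weight_estimation_error_bound
    {E U X Z : Type*}
    [NormedAddCommGroup E] [NormedSpace ℝ E]
    [NormedAddCommGroup U] [NormedSpace ℝ U]
    [NormedAddCommGroup X] [NormedSpace ℝ X]
    [NormedAddCommGroup Z] [NormedSpace ℝ Z]
    (Φ : E → U) (F : Z → X → E) (c7 c9 : ℝ)
    (hc7 : 0 < c7) (hc9 : 0 < c9)
    (hΦ : ∀ p q : E, c7 * ‖p - q‖ ≤ ‖Φ p - Φ q‖)
    (hF : ∀ (z1 z2 : Z) (x : X), c9 * ‖z1 - z2‖ ≤ ‖F z1 x - F z2 x‖)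
    (xs : X) (zs zsn : Z) (w δ : Z) :
    ‖w - δ‖ ≤
      (1 / (c7 * c9)) *
        (‖Φ (F w xs) + (-(Φ (F (δ + zsn) xs - F zs xs)))‖ + c7 * ‖F zs xs‖) + ‖zsn‖ := by
  have h_Φ := hΦ (F w xs) (F (δ + zsn) xs - F zs xs)
  rw [sub_eq_add_neg (Φ _)] at h_Φ
  have h_F := hF w (δ + zsn) xs
  have h_drift : ‖F w xs - F (δ + zsn) xs‖ ≤
      ‖F w xs - (F (δ + zsn) xs - F zs xs)‖ + ‖F zs xs‖ := by
    calc ‖F w xs - F (δ + zsn) xs‖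
        = ‖(F w xs - (F (δ + zsn) xs - F zs xs)) - F zs xs‖ := by congr 1; abel
      _ ≤ _ := norm_sub_le _ _
  have h_weight : ‖w - δ‖ ≤ ‖w - (δ + zsn)‖ + ‖zsn‖ := by
    calc ‖w - δ‖ = ‖(w - (δ + zsn)) + zsn‖ := by congr 1; abel
      _ ≤ _ := norm_add_le _ _
  refine h_weight.trans ?_
  gcongr
  rw [one_div_mul_eq_div, le_div_iff₀ (by positivity)]
  calc ‖w - (δ + zsn)‖ * (c7 * c9) = c7 * (c9 * ‖w - (δ + zsn)‖) := by ring
    _ ≤ c7 * (‖F w xs - (F (δ + zsn) xs - F zs xs)‖ + ‖F zs xs‖) := by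
        gcongr
        exact h_F.trans h_drift
    _ ≤ _ := by
        rw [mul_add]
        gcongr
end
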